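/- There exists a subgroup G ≤ W isomorphic to the symmetric group S₄ such that: the action of G on the 56 exceptional classes has exactly five orbits, of lengths 2, 6, 12, 12, 24, with point stabilizers isomorphic to the alternating group A₄, the Klein four-group C₂ × C₂, the cyclic group C₂, the cyclic group C₂, and the trivial group, respectively; G is minimal; G fixes a conic class; and G satisfies condition (H1). -/

import Mathlib

open scoped BigOperators

noncomputable section

/-- The Picard lattice of a degree 2 del Pezzo surface. -/
abbrev V : Type := Fin 8 → ℤ

/-- The intersection form. -/
def bil (x y : V) : ℤ := x 0 * y 0 - ∑ i ∈ Finset.Ioi (0 : Fin 8), x i * y i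

/-- The canonical class. -/
def Kvec : V := fun i => if i = 0 then -3 else 1

abbrev LatAut := V ≃ₗ[ℤ] V

/-- The Weyl group: automorphisms preserving the form and fixing K. -/
def W : Subgroup LatAut where
  carrier := {g | (∀ x y, bil (g x) (g y) = bil x y) ∧ g Kvec = Kvec}
  one_mem' := ⟨fun _ _ => rfl, rfl⟩
  mul_mem' := by
    rintro a b ⟨ha1, ha2⟩ ⟨hb1, hb2⟩
    refine ⟨fun x y => ?_, ?_⟩
    · show bil (a (b x)) (a (b y)) = bil x y
      rw [ha1, hb1]
    · show a (b Kvec) = Kvec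
      rw [hb2, ha2]
  inv_mem' := by
    rintro a ⟨ha1, ha2⟩
    refine ⟨fun x y => ?_, ?_⟩
    · have h := ha1 (a⁻¹ x) (a⁻¹ y)
      have hx : a (a⁻¹ x) = x := a.apply_symm_apply x
      have hy : a (a⁻¹ y) = y := a.apply_symm_apply y
      rw [hx, hy] at h
      exact h.symm
    · have h2 : a.symm (a Kvec) = a.symm Kvec := by rw [ha2]
      rw [a.symm_apply_apply] at h2
      exact (show a⁻¹ Kvec = a.symm Kvec from rfl).trans h2.symm

/-- Exceptional classes. -/
def Exc : Set V := {E | bil E E = -1 ∧ bil E Kvec = -1}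

/-- Conic classes. -/
def IsConic (C : V) : Prop := bil C C = 0 ∧ bil C Kvec = -2

/-- The orbit of a vector under a subgroup of `LatAut`. -/
def orb (G : Subgroup LatAut) (E : V) : Set V := {v | ∃ g ∈ G, g E = v}

/-- The set of orbits of exceptional classes. -/
def orbs (G : Subgroup LatAut) : Set (Set V) := {S | ∃ E ∈ Exc, S = orb G E}

/-- The stabilizer of a vector, as a subgroup of `LatAut`. -/
def stab (G : Subgroup LatAut) (E : V) : Subgroup LatAut where
  carrier := {g | g ∈ G ∧ g E = E}
  one_mem' := ⟨G.one_mem, rfl⟩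
  mul_mem' := by
    rintro a b ⟨haG, ha⟩ ⟨hbG, hb⟩
    exact ⟨G.mul_mem haG hbG, by show a (b E) = E; rw [hb, ha]⟩
  inv_mem' := by
    rintro a ⟨haG, ha⟩
    refine ⟨G.inv_mem haG, ?_⟩
    conv_lhs => rw [← ha]
    exact a.symm_apply_apply E

/-- `G` is minimal: no nonempty orbit of exceptional classes consists of pairwise
orthogonal classes. -/
def MinimalAction (G : Subgroup LatAut) : Prop :=
  ∀ E ∈ Exc, ¬ (∀ E₁ ∈ orb G E, ∀ E₂ ∈ orb G E, E₁ ≠ E₂ → bil E₁ E₂ = 0)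

/-- The natural representation of a subgroup of `LatAut` on the lattice. -/
def rep (G : Subgroup LatAut) : Representation ℤ G V where
  toFun g := (g : LatAut).toLinearMap
  map_one' := rfl
  map_mul' _ _ := rfl

/-- Condition (H1): the first group cohomology of every subgroup of `G`
with coefficients in the lattice vanishes. -/
def CondH1 (G : Subgroup LatAut) : Prop :=
  ∀ G' : Subgroup LatAut, G' ≤ G →
    Subsingleton (groupCohomology.H1 (Rep.of (rep G')))

/-! ### The bilinear form -/

lemma bil_eq (x y : V) : bil x y = 2 * (x 0 * y 0) - ∑ i, x i * y i := by
  have h : (Finset.Ioi (0 : Fin 8)) = {1, 2, 3, 4, 5, 6, 7} := by decide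
  simp [bil, h, Fin.sum_univ_succ]
  ring

lemma bil_add_left (x y z : V) : bil (x + y) z = bil x z + bil y z := by
  simp only [bil_eq, Pi.add_apply, add_mul, Finset.sum_add_distrib]
  ring

lemma bil_smul_left (a : ℤ) (x z : V) : bil (a • x) z = a * bil x z := by
  simp only [bil_eq, Pi.smul_apply, smul_eq_mul, mul_assoc, ← Finset.mul_sum]
  ring

/-- The form with its second argument fixed, as a linear functional. -/
def bilLeft (z : V) : V →ₗ[ℤ] ℤ where
  toFun x := bil x z
  map_add' x y := bil_add_left x y z
  map_smul' a x := bil_smul_left a x z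

/-! ### A criterion for the vanishing of `H¹`

If the identity of the lattice is `x ↦ ∑ ⟨x, w⟩ v` over a finite stable set of pairs `(w, v)`,
then the lattice is a direct summand of a permutation module, so its `H¹` vanishes. -/

theorem subsingleton_H1_of_finset_pairs (H : Subgroup LatAut) [Finite H] (hW : H ≤ W)
    (s : Finset (V × V)) (hs : ∀ g ∈ H, ∀ p ∈ s, (g p.1, g p.2) ∈ s)
    (hid : ∀ x, ∑ p ∈ s, bil x p.1 • p.2 = x) :
    Subsingleton (groupCohomology.H1 (Rep.of (rep H))) := by
  have : Fintype H := Fintype.ofFinite H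
  refine ⟨fun a b => ?_⟩
  suffices h : ∀ a : groupCohomology.H1 (Rep.of (rep H)), a = 0 by rw [h a, h b]
  intro a
  induction a using groupCohomology.H1_induction_on with
  | h c =>
  rw [groupCohomology.H1π_eq_zero_iff]
  have hc : ∀ g h : H, c (g * h) = (g : LatAut) (c h) + c g :=
    fun g h => (groupCohomology.mem_cocycles₁_iff (A := Rep.of (rep H)) c).1 c.2 g h
  set n : ℤ := (Fintype.card H : ℤ) with hn
  have hn0 : n ≠ 0 := by simp [hn]
  let S : V := ∑ h : H, c h
  have hS : ∀ g : H, (g : LatAut) S = S + (-n) • (c g : V) := by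
    intro g
    have h1 : S = ∑ h : H, c (g * h) := (Equiv.sum_comp (Equiv.mulLeft g) (fun h => (c h : V))).symm
    have h2 : S = (g : LatAut) S + n • (c g : V) := by
      conv_lhs => rw [h1]
      simp only [hc]
      rw [Finset.sum_add_distrib, map_sum]
      simp [hn]
    rw [neg_smul, ← sub_eq_add_neg]
    exact eq_sub_of_add_eq h2.symm
  let q : V × V → ℤ := fun p => bil S p.1 / n
  have hq : ∀ (g : H) (p : V × V),
      q p = q ((g : LatAut) p.1, (g : LatAut) p.2) + bil (c g⁻¹) p.1 := by
    intro g p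
    have h1 : bil S ((g : LatAut) p.1) = bil (((g⁻¹ : H) : LatAut) S) p.1 := by
      rw [← (hW g.2).1 (((g⁻¹ : H) : LatAut) S) p.1]
      congr 1
      exact ((g : LatAut).apply_symm_apply S).symm
    have h2 : bil S p.1 = bil S ((g : LatAut) p.1) + n * bil (c g⁻¹) p.1 := by
      rw [h1, hS, bil_add_left, bil_smul_left]
      ring
    simp only [q]
    rw [h2, Int.add_mul_ediv_left _ _ hn0]
  have hcinv : ∀ g : H, (g : LatAut) (c g⁻¹) + c g = 0 := by
    intro g
    have h1 : (c (1 : H) : V) = c 1 + c 1 := by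
      simpa only [mul_one, OneMemClass.coe_one, LinearEquiv.coe_one, id_eq] using hc 1 1
    have h2 := hc g g⁻¹
    rw [mul_inv_cancel] at h2
    rw [← h2]
    exact left_eq_add.1 h1
  let u : V := -∑ p ∈ s, q p • p.2
  refine ⟨u, funext fun g => ?_⟩
  change (g : LatAut) u - u = c g
  have hperm : ∑ p ∈ s, q ((g : LatAut) p.1, (g : LatAut) p.2) • (g : LatAut) p.2
      = ∑ p ∈ s, q p • p.2 := by
    refine Finset.sum_bij' (fun p _ => ((g : LatAut) p.1, (g : LatAut) p.2))
      (fun p _ => (((g⁻¹ : H) : LatAut) p.1, ((g⁻¹ : H) : LatAut) p.2))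
      (fun p hp => hs _ g.2 p hp) (fun p hp => hs _ (g⁻¹).2 p hp) ?_ ?_ ?_
    · exact fun p _ => Prod.ext ((g : LatAut).symm_apply_apply _) ((g : LatAut).symm_apply_apply _)
    · exact fun p _ => Prod.ext ((g : LatAut).apply_symm_apply _) ((g : LatAut).apply_symm_apply _)
    · exact fun p _ => rfl
  have hgu : (g : LatAut) u = u - (g : LatAut) (c g⁻¹) := by
    conv_rhs => rw [← hid (c g⁻¹)]
    simp only [u, map_neg, map_sum, map_smul]
    rw [← hperm, ← neg_add', ← Finset.sum_add_distrib]
    congr 1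
    refine Finset.sum_congr rfl fun p _ => ?_
    rw [← add_smul, ← hq]
  rw [hgu, eq_neg_of_add_eq_zero_left (hcinv g)]
  abel

/-! ### The action of `S₄` -/

/-- The index of the edge `{a, b}` of the tetrahedron; the edges are numbered `1, …, 6`. -/
def edgeIndex : Fin 4 → Fin 4 → Fin 8 :=
  ![![0, 1, 2, 3], ![1, 0, 4, 5], ![2, 4, 0, 6], ![3, 5, 6, 0]]

/-- The end points of an edge of the tetrahedron. -/
def edgeEnds : Fin 8 → Fin 4 × Fin 4 :=
  ![(0, 0), (0, 1), (0, 2), (0, 3), (1, 2), (1, 3), (2, 3), (0, 0)]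

/-- The map induced on the coordinates by a permutation of the vertices of the tetrahedron:
the coordinates `1, …, 6` are the edges, while `0` and `7` are fixed. -/
def edgeMap (σ : Equiv.Perm (Fin 4)) (i : Fin 8) : Fin 8 :=
  if i = 7 then 7 else edgeIndex (σ (edgeEnds i).1) (σ (edgeEnds i).2)

/-- The action of `S₄` on the coordinates, through the edges of the tetrahedron. -/
def edgePerm : Equiv.Perm (Fin 4) →* Equiv.Perm (Fin 8) :=
  MonoidHom.toHomPerm
    { toFun := fun σ => (edgeMap σ : Function.End (Fin 8))
      map_one' := by
        change edgeMap 1 = id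
        decide +kernel
      map_mul' := by
        change ∀ σ τ, edgeMap (σ * τ) = edgeMap σ ∘ edgeMap τ
        decide +kernel }

lemma edgePerm_zero (σ : Equiv.Perm (Fin 4)) : edgePerm σ 0 = 0 := by
  have h : ∀ a, edgeIndex a a = 0 := by decide
  exact h (σ 0)

lemma edgePerm_seven (σ : Equiv.Perm (Fin 4)) : edgePerm σ 7 = 7 := rfl

/-- Permutation of the coordinates of the lattice. -/
def permHom : Equiv.Perm (Fin 8) →* LatAut where
  toFun τ := LinearEquiv.funCongrLeft ℤ ℤ τ⁻¹
  map_one' := rfl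
  map_mul' _ _ := rfl

lemma permHom_apply (τ : Equiv.Perm (Fin 8)) (x : V) (i : Fin 8) :
    permHom τ x i = x (τ⁻¹ i) := rfl

/-- The underlying map of `fiberFlip`. -/
def flipFun (x : V) (i : Fin 8) : ℤ :=
  if i = 0 then 3 * x 0 + ∑ j, x j + 2 * x 7
  else if i = 7 then -2 * x 0 - ∑ j, x j - x 7
  else -x 0 - x i - x 7

lemma flipFun_flipFun (x : V) : flipFun (flipFun x) = x := by
  ext i
  fin_cases i <;> simp [flipFun, Fin.sum_univ_succ] <;> ring

/-- The involution exchanging the two components of each of the six degenerate fibres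
of the conic bundle `L - E₇`. -/
def fiberFlip : LatAut where
  toFun := flipFun
  invFun := flipFun
  left_inv := flipFun_flipFun
  right_inv := flipFun_flipFun
  map_add' x y := by
    ext i
    simp only [flipFun, Pi.add_apply, Finset.sum_add_distrib]
    split_ifs <;> ring
  map_smul' a x := by
    ext i
    simp only [flipFun, Pi.smul_apply, smul_eq_mul, ← Finset.mul_sum, RingHom.id_apply]
    split_ifs <;> ring

lemma fiberFlip_mul_self : fiberFlip * fiberFlip = 1 := LinearEquiv.ext flipFun_flipFun

lemma fiberFlip_mem_W : fiberFlip ∈ W := by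
  refine ⟨fun x y => ?_, ?_⟩
  · change bil (flipFun x) (flipFun y) = bil x y
    simp only [bil_eq]
    simp [flipFun, Fin.sum_univ_succ]
    ring
  · change flipFun Kvec = Kvec
    decide

lemma permHom_mem_W {τ : Equiv.Perm (Fin 8)} (h : τ 0 = 0) : permHom τ ∈ W := by
  have h' : τ⁻¹ 0 = 0 := by rw [Equiv.Perm.inv_eq_iff_eq, h]
  refine ⟨fun x y => ?_, ?_⟩
  · simp only [bil_eq, permHom_apply, h']
    rw [Equiv.sum_comp τ⁻¹ (fun i => x i * y i)]
  · ext i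
    simp only [permHom_apply, Kvec, Equiv.Perm.inv_eq_iff_eq, h]

lemma commute_permHom_fiberFlip {τ : Equiv.Perm (Fin 8)} (h : τ 0 = 0) (h7 : τ 7 = 7) :
    Commute (permHom τ) fiberFlip := by
  have h0' : τ⁻¹ 0 = 0 := by rw [Equiv.Perm.inv_eq_iff_eq, h]
  have h7' : τ⁻¹ 7 = 7 := by rw [Equiv.Perm.inv_eq_iff_eq, h7]
  refine LinearEquiv.ext fun x => funext fun i => ?_
  change flipFun x (τ⁻¹ i) = flipFun (permHom τ x) i
  simp only [flipFun, permHom_apply, h0', h7', Equiv.Perm.inv_eq_iff_eq, h, h7]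
  rw [Equiv.sum_comp τ⁻¹ x]

/-- The homomorphism sending `-1` to `fiberFlip`. -/
def flipHom : ℤˣ →* LatAut where
  toFun u := if u = 1 then 1 else fiberFlip
  map_one' := rfl
  map_mul' u v := by
    rcases Int.units_eq_one_or u with rfl | rfl <;> rcases Int.units_eq_one_or v with rfl | rfl <;>
      simp [fiberFlip_mul_self]

lemma flipHom_apply (u : ℤˣ) : flipHom u = if u = 1 then 1 else fiberFlip := rfl

/-- The representation of `S₄` on the lattice: permutations of the edges of the tetrahedron,
twisted by `fiberFlip` on odd permutations. -/
def latHom : Equiv.Perm (Fin 4) →* LatAut where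
  toFun σ := flipHom (Equiv.Perm.sign σ) * permHom (edgePerm σ)
  map_one' := by simp
  map_mul' σ τ := by
    have h : Commute (permHom (edgePerm σ)) (flipHom (Equiv.Perm.sign τ)) := by
      rw [flipHom_apply]
      split_ifs
      · exact Commute.one_right _
      · exact commute_permHom_fiberFlip (edgePerm_zero σ) (edgePerm_seven σ)
    rw [map_mul, map_mul, map_mul, map_mul]
    simp only [mul_assoc]
    rw [← mul_assoc (permHom _) (flipHom _), h.eq, mul_assoc]

lemma latHom_mem_W (σ : Equiv.Perm (Fin 4)) : latHom σ ∈ W := by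
  refine W.mul_mem ?_ (permHom_mem_W (edgePerm_zero σ))
  rw [flipHom_apply]
  split_ifs
  · exact W.one_mem
  · exact fiberFlip_mem_W

/-- An explicit form of the action through `latHom`, suited to computation. -/
def act (σ : Equiv.Perm (Fin 4)) (x : V) : V :=
  if Equiv.Perm.sign σ = 1 then fun i => x (edgeMap σ⁻¹ i)
  else flipFun fun i => x (edgeMap σ⁻¹ i)

lemma latHom_apply (σ : Equiv.Perm (Fin 4)) (x : V) : latHom σ x = act σ x := by
  change (if Equiv.Perm.sign σ = 1 then (1 : LatAut) else fiberFlip) (permHom (edgePerm σ) x) = _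
  unfold act
  split_ifs <;> rfl

/-! ### The orbits of exceptional classes -/

/-- Representatives of the orbits of exceptional classes. -/
def excRep : Fin 5 → V :=
  ![![0, 0, 0, 0, 0, 0, 0, 1], ![1, -1, 0, 0, 0, 0, -1, 0], ![0, 1, 0, 0, 0, 0, 0, 0],
    ![3, -2, -1, -1, -1, -1, -1, -1], ![1, -1, -1, 0, 0, 0, 0, 0]]

/-- The orbit of a vector as a finite set. -/
def orbFinset (x : V) : Finset V := Finset.univ.image fun σ => act σ x

lemma card_orbFinset_excRep : ∀ i, (orbFinset (excRep i)).card = ![2, 6, 12, 12, 24] i := by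
  decide +kernel

lemma excRep_notMem_orbFinset : ∀ i j, i ≠ j → excRep i ∉ orbFinset (excRep j) := by
  decide +kernel

lemma excRep_mem_Exc : ∀ i, bil (excRep i) (excRep i) = -1 ∧ bil (excRep i) Kvec = -1 := by
  decide +kernel

lemma exists_bil_excRep_ne_zero :
    ∀ i, ∃ σ, excRep i ≠ act σ (excRep i) ∧ bil (excRep i) (act σ (excRep i)) ≠ 0 := by
  decide +kernel

lemma eq_one_of_act_excRep : ∀ σ, act σ (excRep 4) = excRep 4 → σ = 1 := by
  decide +kernel

lemma sq_eq_one_of_act_eq : ∀ (i : Fin 5) (σ τ : Equiv.Perm (Fin 4)),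
    act σ (act τ (excRep i)) = act τ (excRep i) → σ ^ 2 = 1 ∨ σ ^ 3 = 1 := by
  decide +kernel

/-- A vector whose coordinates `1, …, 7` each take one of two consecutive values. -/
def binaryClass (t : Fin 4) (b : Fin 7 → Bool) : V :=
  Fin.cons (t.val : ℤ) fun i => ![0, -1, -1, -2] t + if b i then 1 else 0

lemma exists_act_eq_binaryClass : ∀ t b, ∑ i, binaryClass t b i = 1 - 2 * (t.val : ℤ) →
    ∃ i σ, act σ (excRep i) = binaryClass t b := by
  decide +kernel

lemma sum_eq_of_mem_Exc {E : V} (hE : E ∈ Exc) :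
    ∑ i : Fin 7, E i.succ = 1 - 3 * E 0 ∧ ∑ i : Fin 7, E i.succ ^ 2 = E 0 ^ 2 + 1 := by
  obtain ⟨h1, h2⟩ := hE
  rw [bil_eq, Fin.sum_univ_succ] at h1 h2
  simp only [Kvec, Fin.succ_ne_zero, if_true, if_false, mul_one] at h2
  simp only [sq]
  constructor <;> linarith

lemma exists_binaryClass_of_mem_Exc {E : V} (hE : E ∈ Exc) : ∃ t b, E = binaryClass t b := by
  obtain ⟨h1, h2⟩ := sum_eq_of_mem_Exc hE
  have hCS : (1 - 3 * E 0) ^ 2 ≤ 7 * (E 0 ^ 2 + 1) := by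
    have h := sq_sum_le_card_mul_sum_sq (s := Finset.univ) (f := fun i : Fin 7 => E i.succ)
    rw [h1, h2] at h
    simpa using h
  have h0 : 0 ≤ E 0 := by by_contra! h; nlinarith
  have h3 : E 0 ≤ 3 := by by_contra! h; nlinarith
  obtain ⟨t, ht⟩ : ∃ t : Fin 4, E 0 = t.val := ⟨⟨(E 0).toNat, by omega⟩, by simp [h0]⟩
  set m : ℤ := ![0, -1, -1, -2] t with hm
  have hsum : ∑ i : Fin 7, (E i.succ - m) * (E i.succ - m - 1) = 0 := by
    have h : ∀ i : Fin 7, (E i.succ - m) * (E i.succ - m - 1)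
        = E i.succ ^ 2 - (2 * m + 1) * E i.succ + m * (m + 1) := fun i => by ring
    simp only [h]
    rw [Finset.sum_add_distrib, Finset.sum_sub_distrib, ← Finset.mul_sum, h1, h2, ht, hm]
    fin_cases t <;> simp
  have hnonneg : ∀ a : ℤ, 0 ≤ a * (a - 1) := fun a => by
    rcases le_or_gt a 0 with h | h
    · nlinarith
    · exact mul_nonneg h.le (by omega)
  rw [Finset.sum_eq_zero_iff_of_nonneg fun i _ => hnonneg _] at hsum
  refine ⟨t, fun i => decide (E i.succ = m + 1), funext fun i => ?_⟩
  refine Fin.cases ht (fun j => ?_) i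
  have hj := mul_eq_zero.1 (hsum j (Finset.mem_univ j))
  simp only [binaryClass, Fin.cons_succ, ← hm, decide_eq_true_eq]
  split_ifs <;> omega

lemma exists_latHom_eq_of_mem_Exc {E : V} (hE : E ∈ Exc) :
    ∃ i σ, latHom σ (excRep i) = E := by
  obtain ⟨t, b, rfl⟩ := exists_binaryClass_of_mem_Exc hE
  simp only [latHom_apply]
  refine exists_act_eq_binaryClass t b ?_
  have h := (sum_eq_of_mem_Exc hE).1
  have h0 : binaryClass t b 0 = t.val := rfl
  rw [Fin.sum_univ_succ, h, h0]
  ring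

lemma orb_range_latHom (x : V) : orb latHom.range x = orbFinset x := by
  ext v
  simp [orb, orbFinset, latHom_apply]

lemma orb_apply_of_mem {G : Subgroup LatAut} {g : LatAut} (hg : g ∈ G) (x : V) :
    orb G (g x) = orb G x := by
  ext v
  constructor
  · rintro ⟨h, hh, rfl⟩
    exact ⟨h * g, G.mul_mem hh hg, rfl⟩
  · rintro ⟨h, hh, rfl⟩
    exact ⟨h * g⁻¹, G.mul_mem hh (G.inv_mem hg), congrArg h (g.symm_apply_apply x)⟩

/-- The orbits of exceptional classes, indexed by their representatives. -/
def excOrb (i : Fin 5) : Set V := orbFinset (excRep i)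

lemma mem_orbFinset_self (x : V) : x ∈ orbFinset x :=
  Finset.mem_image.2 ⟨1, Finset.mem_univ _, by rw [← latHom_apply, map_one]; rfl⟩

lemma excOrb_injective : Function.Injective excOrb := by
  intro i j h
  by_contra hij
  refine excRep_notMem_orbFinset i j hij ?_
  rw [← Finset.coe_inj.1 h]
  exact mem_orbFinset_self _

lemma ncard_excOrb (i : Fin 5) : (excOrb i).ncard = ![2, 6, 12, 12, 24] i := by
  rw [excOrb, Set.ncard_coe_finset, card_orbFinset_excRep]

lemma orbs_range_latHom : orbs latHom.range = Set.range excOrb := by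
  ext S
  constructor
  · rintro ⟨E, hE, rfl⟩
    obtain ⟨i, σ, rfl⟩ := exists_latHom_eq_of_mem_Exc hE
    exact ⟨i, by rw [orb_apply_of_mem (MonoidHom.mem_range.2 ⟨σ, rfl⟩), orb_range_latHom, excOrb]⟩
  · rintro ⟨i, rfl⟩
    exact ⟨excRep i, excRep_mem_Exc i, (orb_range_latHom _).symm⟩

lemma ncard_setOf_orbs (n : ℕ) : {S ∈ orbs latHom.range | S.ncard = n}.ncard =
    (Finset.univ.filter fun i : Fin 5 => ![2, 6, 12, 12, 24] i = n).card := by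
  have h : {S ∈ orbs latHom.range | S.ncard = n} =
      excOrb '' (Finset.univ.filter fun i : Fin 5 => ![2, 6, 12, 12, 24] i = n) := by
    ext S
    rw [orbs_range_latHom]
    constructor
    · rintro ⟨⟨i, rfl⟩, hi⟩
      exact ⟨i, by simpa [ncard_excOrb] using hi, rfl⟩
    · rintro ⟨i, hi, rfl⟩
      exact ⟨⟨i, rfl⟩, by simpa [ncard_excOrb] using hi⟩
  rw [h, Set.ncard_image_of_injective _ excOrb_injective, Set.ncard_coe_finset]

/-! ### Stabilizers -/

lemma latHom_injective : Function.Injective latHom := by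
  rw [injective_iff_map_eq_one]
  intro σ h
  refine eq_one_of_act_excRep σ ?_
  rw [← latHom_apply, h]
  rfl

lemma map_comap_stab (E : V) :
    ((stab latHom.range E).comap latHom).map latHom = stab latHom.range E :=
  Subgroup.map_comap_eq_self fun _ hg => hg.1

/-- The stabilizer of `E` inside `S₄` is isomorphic to its image in the lattice automorphisms. -/
def stabEquiv (E : V) :
    stab latHom.range E ≃* (stab latHom.range E).comap latHom :=
  (MulEquiv.subgroupCongr (map_comap_stab E).symm).trans
    (Subgroup.equivMapOfInjective _ latHom latHom_injective).symm

lemma index_comap_stab (E : V) :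
    ((stab latHom.range E).comap latHom).index = (orb latHom.range E).ncard := by
  let _ : MulAction (Equiv.Perm (Fin 4)) V := MulAction.compHom V latHom
  have h1 : (stab latHom.range E).comap latHom = MulAction.stabilizer (Equiv.Perm (Fin 4)) E := by
    ext σ
    exact ⟨fun h => h.2, fun h => ⟨⟨σ, rfl⟩, h⟩⟩
  have h2 : orb latHom.range E = MulAction.orbit (Equiv.Perm (Fin 4)) E := by
    ext v
    constructor
    · rintro ⟨_, ⟨σ, rfl⟩, rfl⟩
      exact ⟨σ, rfl⟩
    · rintro ⟨σ, rfl⟩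
      exact ⟨latHom σ, ⟨σ, rfl⟩, rfl⟩
  rw [h1, h2, MulAction.index_stabilizer]

lemma ncard_orb_mul_card_stab (E : V) :
    (orb latHom.range E).ncard * Nat.card (stab latHom.range E) = 24 := by
  rw [← index_comap_stab, Nat.card_congr (stabEquiv E).toEquiv, Subgroup.index_mul_card,
    Nat.card_eq_fintype_card, Fintype.card_perm, Fintype.card_fin]
  rfl

lemma stab_mulEquiv_alternatingGroup {E : V} (h : (orb latHom.range E).ncard = 2) :
    Nonempty (stab latHom.range E ≃* alternatingGroup (Fin 4)) := by
  rw [← index_comap_stab] at h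
  exact ⟨(stabEquiv E).trans
    (MulEquiv.subgroupCongr (Equiv.Perm.eq_alternatingGroup_of_index_eq_two h))⟩

lemma sq_eq_one_or_of_mem_stab {E : V} (hE : E ∈ Exc) {g : LatAut}
    (hg : g ∈ stab latHom.range E) : g ^ 2 = 1 ∨ g ^ 3 = 1 := by
  obtain ⟨⟨σ, rfl⟩, hσ⟩ := hg
  obtain ⟨i, τ, rfl⟩ := exists_latHom_eq_of_mem_Exc hE
  simp only [latHom_apply] at hσ
  rw [← map_pow, ← map_pow]
  exact (sq_eq_one_of_act_eq i σ τ hσ).imp (fun h => by rw [h, map_one])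
    (fun h => by rw [h, map_one])

lemma stab_mulEquiv_kleinFour {E : V} (hE : E ∈ Exc) (h : (orb latHom.range E).ncard = 6) :
    Nonempty (stab latHom.range E ≃* Multiplicative (ZMod 2) × Multiplicative (ZMod 2)) := by
  have hcard : Nat.card (stab latHom.range E) = 4 := by
    have := ncard_orb_mul_card_stab E
    rw [h] at this
    omega
  have hsq : ∀ g : stab latHom.range E, g ^ 2 = 1 := by
    intro g
    rcases sq_eq_one_or_of_mem_stab hE g.2 with h2 | h3
    · exact Subtype.ext h2
    · have h4 : g ^ 4 = 1 := by
        have h := pow_card_eq_one' (x := g)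
        rwa [hcard] at h
      have h3' : g ^ 3 = 1 := Subtype.ext h3
      rw [pow_succ, h3', one_mul] at h4
      rw [h4, one_pow]
  have : IsKleinFour (stab latHom.range E) := by
    refine ⟨hcard, ?_⟩
    have : Nontrivial (stab latHom.range E) := by
      have : Finite (stab latHom.range E) := Nat.finite_of_card_ne_zero (by omega)
      exact Finite.one_lt_card_iff_nontrivial.1 (by omega)
    exact (Nat.prime_two.eq_one_or_self_of_dvd _
      (Monoid.exponent_dvd_of_forall_pow_eq_one hsq)).resolve_left
        fun h1 => not_subsingleton _ (Monoid.exp_eq_one_iff.1 h1)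
  have : IsKleinFour (Multiplicative (ZMod 2) × Multiplicative (ZMod 2)) := by
    refine ⟨by simp [Nat.card_eq_fintype_card], ?_⟩
    simp [Monoid.exponent_prod]
  exact IsKleinFour.nonempty_mulEquiv

lemma stab_mulEquiv_cyclic {E : V} (h : (orb latHom.range E).ncard = 12) :
    Nonempty (stab latHom.range E ≃* Multiplicative (ZMod 2)) := by
  have hcard : Nat.card (stab latHom.range E) = 2 := by
    have := ncard_orb_mul_card_stab E
    rw [h] at this
    omega
  have : Fact (Nat.Prime 2) := ⟨Nat.prime_two⟩
  exact ⟨mulEquivOfPrimeCardEq (p := 2) hcard (by simp)⟩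

lemma stab_eq_bot {E : V} (h : (orb latHom.range E).ncard = 24) : stab latHom.range E = ⊥ := by
  have := ncard_orb_mul_card_stab E
  rw [h] at this
  exact Subgroup.card_eq_one.1 (by omega)

/-! ### Minimality, the invariant conic class and `H¹` -/

lemma minimalAction_range_latHom : MinimalAction latHom.range := by
  intro E hE h
  obtain ⟨i, σ, rfl⟩ := exists_latHom_eq_of_mem_Exc hE
  rw [orb_apply_of_mem (MonoidHom.mem_range.2 ⟨σ, rfl⟩)] at h
  obtain ⟨τ, h1, h2⟩ := exists_bil_excRep_ne_zero i
  exact h2 (h _ ⟨1, one_mem _, rfl⟩ _ ⟨latHom τ, ⟨τ, rfl⟩, latHom_apply _ _⟩ h1)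

/-- The class of the conic bundle `L - E₇`. -/
def conicClass : V := ![1, 0, 0, 0, 0, 0, 0, -1]

lemma isConic_conicClass : IsConic conicClass := by
  unfold IsConic
  decide +kernel

lemma act_conicClass : ∀ σ, act σ conicClass = conicClass := by
  decide +kernel

/-- Pairs `(w, v)` with `x = ∑ ⟨x, w⟩ v`: the orbits of two pairs, and two invariant pairs. -/
def dualPairs : Finset (V × V) :=
  (Finset.univ.image fun σ => (latHom σ (excRep 1), latHom σ (-excRep 1))) ∪
  (Finset.univ.image fun σ => (latHom σ ![-1, 1, 1, 0, 0, 1, 0, 0],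
    latHom σ ![1, -1, 0, -1, -1, 0, 0, 0])) ∪
  {(conicClass, conicClass + Kvec), (Kvec, conicClass + 3 • Kvec)}

lemma apply_mem_dualPairs {g : LatAut} (hg : g ∈ latHom.range) {p : V × V} (hp : p ∈ dualPairs) :
    (g p.1, g p.2) ∈ dualPairs := by
  obtain ⟨τ, rfl⟩ := hg
  have hC : latHom τ conicClass = conicClass := (latHom_apply _ _).trans (act_conicClass τ)
  have hK : latHom τ Kvec = Kvec := (latHom_mem_W τ).2
  have horb : ∀ w v : V, p ∈ Finset.univ.image (fun σ => (latHom σ w, latHom σ v)) →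
      (latHom τ p.1, latHom τ p.2) ∈ Finset.univ.image (fun σ => (latHom σ w, latHom σ v)) := by
    intro w v h
    obtain ⟨σ, -, rfl⟩ := Finset.mem_image.1 h
    exact Finset.mem_image.2 ⟨τ * σ, Finset.mem_univ _, by rw [map_mul]; rfl⟩
  rcases Finset.mem_union.1 hp with hp | hp
  · refine Finset.mem_union_left _ ?_
    exact Finset.mem_union.2 ((Finset.mem_union.1 hp).imp (horb _ _) (horb _ _))
  · refine Finset.mem_union_right _ ?_
    rw [Finset.mem_insert, Finset.mem_singleton] at hp ⊢
    rcases hp with rfl | rfl <;> simp only [map_add, map_nsmul, hC, hK, true_or, or_true]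

lemma sum_dualPairs_single : ∀ k : Fin 8,
    ∑ p ∈ dualPairs, bil (Pi.single k 1) p.1 • p.2 = Pi.single k 1 := by
  simp only [dualPairs, latHom_apply]
  decide +kernel

lemma sum_dualPairs (x : V) : ∑ p ∈ dualPairs, bil x p.1 • p.2 = x := by
  have h : ∑ p ∈ dualPairs, (bilLeft p.1).smulRight p.2 = LinearMap.id := by
    refine LinearMap.pi_ext' fun k => LinearMap.ext_ring ?_
    simpa [bilLeft] using sum_dualPairs_single k
  simpa [bilLeft] using LinearMap.congr_fun h x

lemma condH1_range_latHom : CondH1 latHom.range := by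
  intro H hH
  have : Finite latHom.range := Finite.of_surjective _ latHom.rangeRestrict_surjective
  have : Finite H := Finite.of_injective _ (Subgroup.inclusion_injective hH)
  refine subsingleton_H1_of_finset_pairs H (fun g hg => ?_) dualPairs
    (fun g hg p hp => apply_mem_dualPairs (hH hg) hp) sum_dualPairs
  obtain ⟨σ, rfl⟩ := hH hg
  exact latHom_mem_W σ

theorem exists_dp2_S4_conic :
    ∃ G : Subgroup LatAut, G ≤ W ∧
      Nonempty (G ≃* Equiv.Perm (Fin 4)) ∧
      (orbs G).ncard = 5 ∧
      {S ∈ orbs G | S.ncard = 2}.ncard = 1 ∧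
      {S ∈ orbs G | S.ncard = 6}.ncard = 1 ∧
      {S ∈ orbs G | S.ncard = 12}.ncard = 2 ∧
      {S ∈ orbs G | S.ncard = 24}.ncard = 1 ∧
      (∀ E ∈ Exc,
        ((orb G E).ncard = 2 → Nonempty (stab G E ≃* alternatingGroup (Fin 4))) ∧
        ((orb G E).ncard = 6 →
          Nonempty (stab G E ≃* (Multiplicative (ZMod 2) × Multiplicative (ZMod 2)))) ∧
        ((orb G E).ncard = 12 → Nonempty (stab G E ≃* Multiplicative (ZMod 2))) ∧
        ((orb G E).ncard = 24 → stab G E = ⊥)) ∧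
      MinimalAction G ∧
      (∃ C, IsConic C ∧ ∀ g ∈ G, g C = C) ∧
      CondH1 G := by
  refine ⟨latHom.range, ?_, ⟨(MonoidHom.ofInjective latHom_injective).symm⟩, ?_, ?_, ?_, ?_, ?_,
    fun E hE => ⟨stab_mulEquiv_alternatingGroup, stab_mulEquiv_kleinFour hE,
      stab_mulEquiv_cyclic, stab_eq_bot⟩,
    minimalAction_range_latHom, ⟨conicClass, isConic_conicClass, ?_⟩, condH1_range_latHom⟩
  · rintro _ ⟨σ, rfl⟩
    exact latHom_mem_W σ
  · rw [orbs_range_latHom, Set.ncard_range_of_injective excOrb_injective]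
    simp
  · rw [ncard_setOf_orbs]; decide
  · rw [ncard_setOf_orbs]; decide
  · rw [ncard_setOf_orbs]; decide
  · rw [ncard_setOf_orbs]; decide
  · rintro _ ⟨σ, rfl⟩
    exact (latHom_apply _ _).trans (act_conicClass σ)

end
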